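/- arXiv:1809.07105 — 13 statements merged into one kernel-verified Lean document; each statement's English description precedes it below -/
import Mathlib

section
/- Criterion for the existence of a first integral (Theorems 0.1–0.2): Let Ω ⊆ ℝ × ℝⁿ be open, let X be continuously differentiable on Ω, and let F : ℝ × ℝⁿ → ℝ be continuously differentiable on Ω. Then the following are equivalent: (i) F is constant along every solution of the system lying in Ω, i.e. for every open interval I ⊆ ℝ, every function x : ℝ → ℝⁿ such that for all t ∈ I one has (t, x(t)) ∈ Ω and x'(t) = X(t, x(t)), and all t₁, t₂ ∈ I, it holds that F(t₁, x(t₁)) = F(t₂, x(t₂)); (ii) 𝔡F(t,x) = 0 for all (t,x) ∈ Ω. -/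
/-- Local existence for a nonautonomous system `dx/dt = X(t,x)` whose right-hand side is `C¹` at
the initial point of the extended phase space; the graph stays in a prescribed neighbourhood. -/
theorem exists_Ioo_hasDerivAt_of_contDiffAt {E : Type*} [NormedAddCommGroup E] [NormedSpace ℝ E]
    [CompleteSpace E] {X : ℝ × E → E} {t₀ : ℝ} {x₀ : E} (hX : ContDiffAt ℝ 1 X (t₀, x₀))
    {U : Set (ℝ × E)} (hU : U ∈ nhds (t₀, x₀)) :
    ∃ x : ℝ → E, x t₀ = x₀ ∧ ∃ ε > (0 : ℝ), ∀ t ∈ Set.Ioo (t₀ - ε) (t₀ + ε),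
      (t, x t) ∈ U ∧ HasDerivAt x (X (t, x t)) t := by
  have hV : ContDiffAt ℝ 1 (fun z : ℝ × E => ((1 : ℝ), X z)) (t₀, x₀) := contDiffAt_const.prodMk hX
  obtain ⟨α, hα₀, ε, hε, hα⟩ :=
    hV.exists_forall_mem_closedBall_exists_eq_forall_mem_Ioo_hasDerivAt₀ t₀
  have ht₀ : t₀ ∈ Set.Ioo (t₀ - ε) (t₀ + ε) := by constructor <;> linarith
  have hfst : ∀ t ∈ Set.Ioo (t₀ - ε) (t₀ + ε), HasDerivAt (fun s => (α s).1) 1 t := fun t ht =>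
    (hasFDerivAt_fst (𝕜 := ℝ) (p := α t)).comp_hasDerivAt t (hα t ht)
  have hsnd : ∀ t ∈ Set.Ioo (t₀ - ε) (t₀ + ε), HasDerivAt (fun s => (α s).2) (X (α t)) t :=
    fun t ht => (hasFDerivAt_snd (𝕜 := ℝ) (p := α t)).comp_hasDerivAt t (hα t ht)
  have htime : Set.EqOn (fun s => (α s).1) id (Set.Ioo (t₀ - ε) (t₀ + ε)) := by
    refine isOpen_Ioo.eqOn_of_deriv_eq isPreconnected_Ioo
      (fun t ht => (hfst t ht).differentiableAt.differentiableWithinAt)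
      differentiableOn_id (fun t ht => ?_) ht₀ (by simp [hα₀])
    rw [(hfst t ht).deriv, deriv_id]
  have hgraph : ∀ t ∈ Set.Ioo (t₀ - ε) (t₀ + ε), (t, (α t).2) = α t := fun t ht =>
    Prod.ext (htime ht).symm rfl
  have hmem : ∀ᶠ t in nhds t₀, α t ∈ U :=
    (hα t₀ ht₀).continuousAt.eventually_mem (hα₀ ▸ hU)
  obtain ⟨δ, hδ, hball⟩ := Metric.eventually_nhds_iff_ball.mp hmem
  refine ⟨fun t => (α t).2, by simp [hα₀], min ε δ, lt_min hε hδ, fun t ht => ?_⟩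
  have htε : t ∈ Set.Ioo (t₀ - ε) (t₀ + ε) :=
    ⟨by linarith [ht.1, min_le_left ε δ], by linarith [ht.2, min_le_left ε δ]⟩
  have htδ : t ∈ Metric.ball t₀ δ := by
    rw [Real.ball_eq_Ioo]
    exact ⟨by linarith [ht.1, min_le_right ε δ], by linarith [ht.2, min_le_right ε δ]⟩
  simp only [hgraph t htε]
  exact ⟨hball t htδ, hsnd t htε⟩

/-- Along a solution of `dx/dt = X(t,x)`, the time derivative of `F` is its derivative by virtue
of the system. -/
theorem hasDerivAt_comp_graph {E : Type*} [NormedAddCommGroup E] [NormedSpace ℝ E]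
    {F : ℝ × E → ℝ} {x : ℝ → E} {v : E} {t : ℝ} (hF : DifferentiableAt ℝ F (t, x t))
    (hx : HasDerivAt x v t) :
    HasDerivAt (fun s => F (s, x s)) (fderiv ℝ F (t, x t) (1, v)) t :=
  hF.hasFDerivAt.comp_hasDerivAt t ((hasDerivAt_id t).prodMk hx)

/-- Criterion for the existence of a first integral (Theorems 0.1–0.2):
a C¹ function `F` is constant along every solution of the system `dx/dt = X(t,x)`
lying in the open set `Ω` iff its derivative by virtue of the system vanishes on `Ω`. -/
theorem first_integral_criterion {n : ℕ}
    (X : ℝ × (Fin n → ℝ) → (Fin n → ℝ))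
    (Ω : Set (ℝ × (Fin n → ℝ))) (hΩ : IsOpen Ω)
    (hX : ContDiffOn ℝ 1 X Ω)
    (F : ℝ × (Fin n → ℝ) → ℝ) (hF : ContDiffOn ℝ 1 F Ω) :
    (∀ (a b : ℝ) (x : ℝ → (Fin n → ℝ)),
        (∀ t ∈ Set.Ioo a b, (t, x t) ∈ Ω) →
        (∀ t ∈ Set.Ioo a b, HasDerivAt x (X (t, x t)) t) →
        ∀ t₁ ∈ Set.Ioo a b, ∀ t₂ ∈ Set.Ioo a b, F (t₁, x t₁) = F (t₂, x t₂)) ↔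
      (∀ z ∈ Ω, fderiv ℝ F z (1, X z) = 0) := by
  have hFd : ∀ z ∈ Ω, DifferentiableAt ℝ F z := fun z hz =>
    (hF.contDiffAt (hΩ.mem_nhds hz)).differentiableAt one_ne_zero
  constructor
  · rintro h ⟨t₀, x₀⟩ hz
    obtain ⟨x, rfl, ε, hε, hx⟩ :=
      exists_Ioo_hasDerivAt_of_contDiffAt (hX.contDiffAt (hΩ.mem_nhds hz)) (hΩ.mem_nhds hz)
    have ht₀ : t₀ ∈ Set.Ioo (t₀ - ε) (t₀ + ε) := by constructor <;> linarith
    have hconst : (fun s => F (s, x s)) =ᶠ[nhds t₀] fun _ => F (t₀, x t₀) := by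
      filter_upwards [isOpen_Ioo.mem_nhds ht₀] with s hs
      exact h _ _ x (fun t ht => (hx t ht).1) (fun t ht => (hx t ht).2) s hs t₀ ht₀
    exact (hasDerivAt_comp_graph (hFd _ hz) (hx t₀ ht₀).2).unique
      ((hasDerivAt_const t₀ _).congr_of_eventuallyEq hconst)
  · intro h a b x hmem hx t₁ ht₁ t₂ ht₂
    have hd : ∀ t ∈ Set.Ioo a b, HasDerivAt (fun s => F (s, x s)) 0 t := fun t ht =>
      h _ (hmem t ht) ▸ hasDerivAt_comp_graph (hFd _ (hmem t ht)) (hx t ht)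
    exact isOpen_Ioo.is_const_of_deriv_eq_zero isPreconnected_Ioo
      (fun t ht => (hd t ht).differentiableAt.differentiableWithinAt)
      (fun t ht => (hd t ht).deriv) ht₁ ht₂
end

section
/- Jacobi property of last multipliers (Property 0.2): Let Ω ⊆ ℝ × ℝⁿ be open, suppose each component Xᵢ is differentiable in the spatial variables so that div𝔡 is defined on Ω, and let μ₁, μ₂ : ℝ × ℝⁿ → ℝ be differentiable on Ω with 𝔡μⱼ(t,x) = −μⱼ(t,x)·div𝔡(t,x) for all (t,x) ∈ Ω, j = 1,2. Then μ₁/μ₂ is a first integral on Ω₀ := {(t,x) ∈ Ω : μ₂(t,x) ≠ 0}: for every (t,x) ∈ Ω₀, 𝔡(μ₁/μ₂)(t,x) = 0. -/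
/-- Jacobi property of last multipliers (Property 0.2): the quotient of two last
multipliers is a first integral on the set where the denominator does not vanish. -/
theorem jacobi_property_last_multipliers {n : ℕ}
    (X : ℝ × (Fin n → ℝ) → (Fin n → ℝ))
    (Ω : Set (ℝ × (Fin n → ℝ))) (hΩ : IsOpen Ω)
    (hXdiff : ∀ z ∈ Ω, ∀ i : Fin n,
      DifferentiableAt ℝ (fun y : Fin n → ℝ => X (z.1, y) i) z.2)
    (μ₁ μ₂ : ℝ × (Fin n → ℝ) → ℝ)
    (hμ₁ : ∀ z ∈ Ω, DifferentiableAt ℝ μ₁ z)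
    (hμ₂ : ∀ z ∈ Ω, DifferentiableAt ℝ μ₂ z)
    (h₁ : ∀ z ∈ Ω, fderiv ℝ μ₁ z (1, X z) =
      -μ₁ z * ∑ i : Fin n, fderiv ℝ (fun y : Fin n → ℝ => X (z.1, y) i) z.2 (Pi.single i 1))
    (h₂ : ∀ z ∈ Ω, fderiv ℝ μ₂ z (1, X z) =
      -μ₂ z * ∑ i : Fin n, fderiv ℝ (fun y : Fin n → ℝ => X (z.1, y) i) z.2 (Pi.single i 1)) :
    ∀ z ∈ Ω, μ₂ z ≠ 0 → fderiv ℝ (fun w => μ₁ w / μ₂ w) z (1, X z) = 0 := by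
  intro z hz hne
  have hinv := (hasDerivAt_inv hne).comp_hasFDerivAt z (hμ₂ z hz).hasFDerivAt
  have hd : fderiv ℝ (fun w => μ₁ w / μ₂ w) z = _ :=
    ((hμ₁ z hz).hasFDerivAt.mul hinv).fderiv
  rw [hd]
  simp only [add_apply, smul_apply, smul_eq_mul,
    Function.comp_apply, h₁ z hz, h₂ z hz]
  field_simp
  ring
end

section
/- Exponential of a quotient of partial integrals (Property 3.10, sufficiency): Let Ω ⊆ ℝ × ℝⁿ be open, let p, q : ℝ × ℝⁿ → ℝ be differentiable on Ω, and let M, N : ℝ × ℝⁿ → ℝ be such that 𝔡p(t,x) = p(t,x)·M(t,x) and 𝔡q(t,x) = q(t,x)·M(t,x) + p(t,x)·N(t,x) for all (t,x) ∈ Ω. Then for every (t,x) ∈ Ω with p(t,x) ≠ 0, 𝔡(exp(q/p))(t,x) = exp(q(t,x)/p(t,x))·N(t,x); that is, exp(q/p) is an exponential partial integral with cofactor N on {(t,x) ∈ Ω : p(t,x) ≠ 0}. -/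
/-- Exponential of a quotient of partial integrals (Property 3.10, sufficiency):
if `𝔡p = p·M` and `𝔡q = q·M + p·N` on `Ω`, then `exp (q / p)` is an exponential
partial integral with cofactor `N` on `{z ∈ Ω | p z ≠ 0}`. -/
theorem exp_quotient_partial_integral {n : ℕ}
    (X : ℝ × (Fin n → ℝ) → (Fin n → ℝ))
    (Ω : Set (ℝ × (Fin n → ℝ))) (hΩ : IsOpen Ω)
    (p q : ℝ × (Fin n → ℝ) → ℝ)
    (hp : ∀ z ∈ Ω, DifferentiableAt ℝ p z)
    (hq : ∀ z ∈ Ω, DifferentiableAt ℝ q z)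
    (M N : ℝ × (Fin n → ℝ) → ℝ)
    (hpM : ∀ z ∈ Ω, fderiv ℝ p z (1, X z) = p z * M z)
    (hqM : ∀ z ∈ Ω, fderiv ℝ q z (1, X z) = q z * M z + p z * N z) :
    ∀ z ∈ Ω, p z ≠ 0 →
      fderiv ℝ (fun w => Real.exp (q w / p w)) z (1, X z) =
        Real.exp (q z / p z) * N z := by
  intro z hz hpz
  have hinv : HasFDerivAt (fun w => (p w)⁻¹) (-(p z ^ 2)⁻¹ • fderiv ℝ p z) z :=
    (hasDerivAt_inv hpz).comp_hasFDerivAt z (hp z hz).hasFDerivAt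
  have hexp := ((hq z hz).hasFDerivAt.mul hinv).exp
  have heq : (fun w => Real.exp (q w / p w)) = fun w => Real.exp ((q * fun w => (p w)⁻¹) w) := by
    funext w
    simp [div_eq_mul_inv]
  rw [heq, hexp.fderiv]
  simp only [smul_apply, add_apply, smul_eq_mul,
    Pi.mul_apply, hpM z hz, hqM z hz, div_eq_mul_inv]
  field_simp
  ring
end

section
/- Exponential of an arctangent (Property 3.11, sufficiency): Let Ω ⊆ ℝ × ℝⁿ be open, let u, v : ℝ × ℝⁿ → ℝ be differentiable on Ω, and let U, V : ℝ × ℝⁿ → ℝ be such that 𝔡u(t,x) = u(t,x)·U(t,x) − v(t,x)·V(t,x) and 𝔡v(t,x) = u(t,x)·V(t,x) + v(t,x)·U(t,x) for all (t,x) ∈ Ω. Then for every (t,x) ∈ Ω with u(t,x) ≠ 0, 𝔡(exp(arctan(v/u)))(t,x) = exp(arctan(v(t,x)/u(t,x)))·V(t,x). -/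
/-- Exponential of an arctangent (Property 3.11, sufficiency):
if `𝔡u = u·U − v·V` and `𝔡v = u·V + v·U` on `Ω`, then at every point of `Ω` where
`u ≠ 0` one has `𝔡(exp (arctan (v/u))) = exp (arctan (v/u)) · V`. -/
theorem exp_arctan_partial_integral {n : ℕ}
    (X : ℝ × (Fin n → ℝ) → (Fin n → ℝ))
    (Ω : Set (ℝ × (Fin n → ℝ))) (hΩ : IsOpen Ω)
    (u v : ℝ × (Fin n → ℝ) → ℝ)
    (hu : ∀ z ∈ Ω, DifferentiableAt ℝ u z)
    (hv : ∀ z ∈ Ω, DifferentiableAt ℝ v z)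
    (U V : ℝ × (Fin n → ℝ) → ℝ)
    (huU : ∀ z ∈ Ω, fderiv ℝ u z (1, X z) = u z * U z - v z * V z)
    (hvV : ∀ z ∈ Ω, fderiv ℝ v z (1, X z) = u z * V z + v z * U z) :
    ∀ z ∈ Ω, u z ≠ 0 →
      fderiv ℝ (fun w => Real.exp (Real.arctan (v w / u w))) z (1, X z) =
        Real.exp (Real.arctan (v z / u z)) * V z := by
  intro z hz huz
  have hinv : HasFDerivAt (fun w => (u w)⁻¹) (-(u z ^ 2)⁻¹ • fderiv ℝ u z) z :=
    (hasDerivAt_inv huz).comp_hasFDerivAt z (hu z hz).hasFDerivAt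
  have hquot : HasFDerivAt (fun w => v w / u w)
      (v z • (-(u z ^ 2)⁻¹ • fderiv ℝ u z) + (u z)⁻¹ • fderiv ℝ v z) z := by
    simpa only [div_eq_mul_inv] using (hv z hz).hasFDerivAt.fun_mul hinv
  rw [hquot.arctan.exp.fderiv]
  simp only [smul_apply, add_apply, smul_eq_mul,
    huU z hz, hvV z hz]
  congr 1
  field_simp
  ring
end

section
/- Multiplicity produced by a cofactor divisible by a power of the integral (Property 5.9): Let Ω ⊆ ℝ × ℝⁿ be open, let k ∈ ℕ with k ≥ 1, let φ : ℝ → ℝ be continuous, let t₀ ∈ ℝ, let p : ℝ × ℝⁿ → ℝ be differentiable on Ω, and let M₀ : ℝ × ℝⁿ → ℝ satisfy 𝔡p(t,x) = p(t,x)·(φ(t) + p(t,x)^k·M₀(t,x)) for all (t,x) ∈ Ω. Define q(t) := exp(k·∫_{t₀}^{t} φ(τ) dτ). Then for every (t,x) ∈ Ω with p(t,x) ≠ 0, the function (t,x) ↦ q(t)/p(t,x)^k satisfies 𝔡(q(t)/p^k)(t,x) = −k·q(t)·M₀(t,x). -/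
/-- Multiplicity produced by a cofactor divisible by a power of the integral
(Property 5.9): if `𝔡p = p·(φ(t) + p^k·M₀)` on `Ω` and
`q(t) = exp (k·∫_{t₀}^t φ)`, then at every point of `Ω` with `p ≠ 0`,
`𝔡(q / p^k) = −k·q·M₀`. -/
theorem multiplicity_from_cofactor_power {n : ℕ}
    (X : ℝ × (Fin n → ℝ) → (Fin n → ℝ))
    (Ω : Set (ℝ × (Fin n → ℝ))) (hΩ : IsOpen Ω)
    (k : ℕ) (hk : 1 ≤ k)
    (φ : ℝ → ℝ) (hφ : Continuous φ) (t₀ : ℝ)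
    (p : ℝ × (Fin n → ℝ) → ℝ)
    (hp : ∀ z ∈ Ω, DifferentiableAt ℝ p z)
    (M₀ : ℝ × (Fin n → ℝ) → ℝ)
    (hpM : ∀ z ∈ Ω, fderiv ℝ p z (1, X z) = p z * (φ z.1 + p z ^ k * M₀ z)) :
    ∀ z ∈ Ω, p z ≠ 0 →
      fderiv ℝ (fun w => Real.exp ((k : ℝ) * ∫ τ in t₀..w.1, φ τ) / p w ^ k) z (1, X z) =
        -(k : ℝ) * Real.exp ((k : ℝ) * ∫ τ in t₀..z.1, φ τ) * M₀ z := by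
  intro z hz hpz
  have hF : HasDerivAt (fun t => Real.exp ((k : ℝ) * ∫ τ in t₀..t, φ τ))
      (Real.exp ((k : ℝ) * ∫ τ in t₀..z.1, φ τ) * ((k : ℝ) * φ z.1)) z.1 :=
    ((hφ.integral_hasStrictDerivAt t₀ z.1).hasDerivAt.const_mul (k : ℝ)).exp
  have hQ := hF.comp_hasFDerivAt z (hasFDerivAt_fst (𝕜 := ℝ) (E := ℝ) (F := Fin n → ℝ) (p := z))
  have hG := ((hasDerivAt_pow k (p z)).inv (pow_ne_zero k hpz)).comp_hasFDerivAt z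
    (hp z hz).hasFDerivAt
  have hD := (hQ.mul hG).fderiv
  have hfun : (fun w : ℝ × (Fin n → ℝ) =>
      Real.exp ((k : ℝ) * ∫ τ in t₀..w.1, φ τ) / p w ^ k) =
      ((fun t => Real.exp ((k : ℝ) * ∫ τ in t₀..t, φ τ)) ∘ Prod.fst) *
        ((fun y : ℝ => y ^ k)⁻¹ ∘ p) := by
    ext w
    simp [div_eq_mul_inv]
  rw [hfun]
  refine (congrArg (fun L => L (1, X z)) hD).trans ?_
  obtain ⟨m, rfl⟩ := Nat.exists_eq_add_of_le' hk
  simp only [add_apply, smul_apply, ContinuousLinearMap.coe_fst',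
    smul_eq_mul, Function.comp_apply, Pi.inv_apply, hpM z hz,
    Nat.add_sub_cancel]
  field_simp
  ring
end

section
/- Existence criterion of complex-valued polynomial partial integral (Theorem 6.2, pointwise form): Let Ω ⊆ ℝ × ℝⁿ be open, let u, v : ℝ × ℝⁿ → ℝ be differentiable on Ω, and let U, V : ℝ × ℝⁿ → ℝ. Then for every (t,x) ∈ Ω with u(t,x) ≠ 0 the following are equivalent: (i) 𝔡u(t,x) = u(t,x)·U(t,x) − v(t,x)·V(t,x) and 𝔡v(t,x) = u(t,x)·V(t,x) + v(t,x)·U(t,x); (ii) 𝔡(u² + v²)(t,x) = 2·(u(t,x)² + v(t,x)²)·U(t,x) and 𝔡(exp(arctan(v/u)))(t,x) = exp(arctan(v(t,x)/u(t,x)))·V(t,x). -/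
section

variable {E : Type*} [NormedAddCommGroup E] [NormedSpace ℝ E] {u v : E → ℝ} {z : E}

theorem fderiv_sq_add_sq_apply (hu : DifferentiableAt ℝ u z) (hv : DifferentiableAt ℝ v z)
    (y : E) :
    fderiv ℝ (fun w => u w ^ 2 + v w ^ 2) z y =
      2 * (u z * fderiv ℝ u z y + v z * fderiv ℝ v z y) := by
  have h := HasFDerivAt.fun_add (hu.hasFDerivAt.pow 2) (hv.hasFDerivAt.pow 2)
  rw [h.fderiv]
  simp
  ring

theorem fderiv_exp_arctan_div_apply (hu : DifferentiableAt ℝ u z) (hv : DifferentiableAt ℝ v z)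
    (hz : u z ≠ 0) (y : E) :
    fderiv ℝ (fun w => Real.exp (Real.arctan (v w / u w))) z y =
      Real.exp (Real.arctan (v z / u z)) *
        ((u z * fderiv ℝ v z y - v z * fderiv ℝ u z y) / (u z ^ 2 + v z ^ 2)) := by
  have hr : u z ^ 2 + v z ^ 2 ≠ 0 := by positivity
  have h := (HasFDerivAt.fun_mul hv.hasFDerivAt
    ((hasDerivAt_inv hz).comp_hasFDerivAt z hu.hasFDerivAt)).arctan.exp
  simp only [Function.comp_apply, ← div_eq_mul_inv] at h
  rw [h.fderiv]
  simp
  field_simp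
  ring

end

/-- For `u ≠ 0`, the complex number `a + ib` equals `(u + iv) (p + iq)` if and only if
`(u - iv) (a + ib)` equals `(u² + v²) (p + iq)`. -/
theorem eq_mul_sub_and_eq_mul_add_iff {u v a b p q : ℝ} (hu : u ≠ 0) :
    (a = u * p - v * q ∧ b = u * q + v * p) ↔
      (u * a + v * b = (u ^ 2 + v ^ 2) * p ∧ u * b - v * a = (u ^ 2 + v ^ 2) * q) := by
  have hr : u ^ 2 + v ^ 2 ≠ 0 := by positivity
  constructor
  · rintro ⟨rfl, rfl⟩
    constructor <;> ring
  · rintro ⟨h₁, h₂⟩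
    constructor <;> apply mul_left_cancel₀ hr
    · linear_combination u * h₁ - v * h₂
    · linear_combination v * h₁ + u * h₂


/-- Existence criterion of complex-valued polynomial partial integral
(Theorem 6.2, pointwise form): at every point of `Ω` with `u ≠ 0`, the pair of
identities `𝔡u = u·U − v·V`, `𝔡v = u·V + v·U` is equivalent to the pair
`𝔡(u² + v²) = 2·(u² + v²)·U`, `𝔡(exp (arctan (v/u))) = exp (arctan (v/u))·V`. -/
theorem complex_partial_integral_criterion {n : ℕ}
    (X : ℝ × (Fin n → ℝ) → (Fin n → ℝ))
    (Ω : Set (ℝ × (Fin n → ℝ))) (hΩ : IsOpen Ω)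
    (u v : ℝ × (Fin n → ℝ) → ℝ)
    (hu : ∀ z ∈ Ω, DifferentiableAt ℝ u z)
    (hv : ∀ z ∈ Ω, DifferentiableAt ℝ v z)
    (U V : ℝ × (Fin n → ℝ) → ℝ) :
    ∀ z ∈ Ω, u z ≠ 0 →
      ((fderiv ℝ u z (1, X z) = u z * U z - v z * V z ∧
          fderiv ℝ v z (1, X z) = u z * V z + v z * U z) ↔
        (fderiv ℝ (fun w => u w ^ 2 + v w ^ 2) z (1, X z) =
            2 * (u z ^ 2 + v z ^ 2) * U z ∧
          fderiv ℝ (fun w => Real.exp (Real.arctan (v w / u w))) z (1, X z) =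
            Real.exp (Real.arctan (v z / u z)) * V z)) := by
  intro z hz huz
  have hr : u z ^ 2 + v z ^ 2 ≠ 0 := by positivity
  rw [fderiv_sq_add_sq_apply (hu z hz) (hv z hz),
    fderiv_exp_arctan_div_apply (hu z hz) (hv z hz) huz, mul_assoc,
    mul_right_inj' two_ne_zero, mul_right_inj' (Real.exp_ne_zero _), div_eq_iff hr,
    mul_comm (V z) (u z ^ 2 + v z ^ 2)]
  exact eq_mul_sub_and_eq_mul_add_iff huz
end

section
/- Last multipliers from products of partial integrals (Property 8.8): Let Ω ⊆ ℝ × ℝⁿ be open, suppose each component Xᵢ is differentiable in the spatial variables so that div𝔡 is defined on Ω, let g₁,…,g_m : ℝ × ℝⁿ → ℝ be differentiable on Ω with gⱼ(t,x) > 0 for all (t,x) ∈ Ω, let γ₁,…,γ_m ∈ ℝ \ {0}, and suppose 𝔡gⱼ(t,x) = gⱼ(t,x)·Mⱼ(t,x) on Ω for j = 1,…,m. Then ∏ⱼ gⱼ^{γⱼ} (real powers) is a last multiplier on Ω — i.e. 𝔡(∏ⱼ gⱼ^{γⱼ})(t,x) = −(∏ⱼ gⱼ(t,x)^{γⱼ})·div𝔡(t,x)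 for all (t,x) ∈ Ω — if and only if Σⱼ γⱼ·Mⱼ(t,x) = −div𝔡(t,x) for all (t,x) ∈ Ω. -/
/-- If `f j` has logarithmic derivative `M j` at `z` in the direction `v`, then `∏ j, f j ^ γ j` has
logarithmic derivative `∑ j, γ j * M j`. -/
theorem fderiv_prod_rpow_apply {E ι : Type*} [NormedAddCommGroup E] [NormedSpace ℝ E]
    [Fintype ι] {f : ι → E → ℝ} {M : ι → ℝ} {z v : E} (γ : ι → ℝ)
    (hf : ∀ j, DifferentiableAt ℝ (f j) z) (hpos : ∀ j, 0 < f j z)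
    (hM : ∀ j, fderiv ℝ (f j) z v = f j z * M j) :
    fderiv ℝ (fun w => ∏ j, f j w ^ γ j) z v = (∏ j, f j z ^ γ j) * ∑ j, γ j * M j := by
  classical
  have hd (j : ι) : HasFDerivAt (fun w => f j w ^ γ j)
      ((γ j * f j z ^ (γ j - 1)) • fderiv ℝ (f j) z) z :=
    (hf j).hasFDerivAt.rpow_const (Or.inl (hpos j).ne')
  rw [(HasFDerivAt.finsetProd (u := Finset.univ) fun j _ => hd j).fderiv]
  simp only [sum_apply, smul_apply, smul_eq_mul, hM, Finset.mul_sum]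
  refine Finset.sum_congr rfl fun j hj => ?_
  rw [← Finset.prod_erase_mul _ _ hj, Real.rpow_sub_one (hpos j).ne']
  field_simp [(hpos j).ne']

/-- Last multipliers from products of partial integrals (Property 8.8): if `g j` are
positive partial integrals with cofactors `M j` on `Ω` and `γ j ≠ 0`, then
`∏ j, (g j) ^ (γ j)` is a last multiplier on `Ω` iff
`∑ j, γ j * M j = −div𝔡` on `Ω`. -/
theorem last_multiplier_from_partial_integrals {n m : ℕ}
    (X : ℝ × (Fin n → ℝ) → (Fin n → ℝ))
    (Ω : Set (ℝ × (Fin n → ℝ))) (hΩ : IsOpen Ω)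
    (hXdiff : ∀ z ∈ Ω, ∀ i : Fin n,
      DifferentiableAt ℝ (fun y : Fin n → ℝ => X (z.1, y) i) z.2)
    (g M : Fin m → ℝ × (Fin n → ℝ) → ℝ) (γ : Fin m → ℝ)
    (hγ : ∀ j, γ j ≠ 0)
    (hg : ∀ j, ∀ z ∈ Ω, DifferentiableAt ℝ (g j) z)
    (hpos : ∀ j, ∀ z ∈ Ω, 0 < g j z)
    (h : ∀ j, ∀ z ∈ Ω, fderiv ℝ (g j) z (1, X z) = g j z * M j z) :
    (∀ z ∈ Ω, fderiv ℝ (fun w => ∏ j, g j w ^ γ j) z (1, X z) =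
        -(∏ j, g j z ^ γ j) *
          ∑ i : Fin n, fderiv ℝ (fun y : Fin n → ℝ => X (z.1, y) i) z.2 (Pi.single i 1)) ↔
      (∀ z ∈ Ω, ∑ j, γ j * M j z =
        -∑ i : Fin n, fderiv ℝ (fun y : Fin n → ℝ => X (z.1, y) i) z.2 (Pi.single i 1)) := by
  refine forall₂_congr fun z hz => ?_
  rw [fderiv_prod_rpow_apply γ (fun j => hg j z hz) (fun j => hpos j z hz) (fun j => h j z hz),
    neg_mul, ← mul_neg]
  exact mul_right_inj' (Finset.prod_pos fun j _ => Real.rpow_pos_of_pos (hpos j z hz) _).ne'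
end

section
/- Eigenvectors give linear partial integrals of the Jacobi equation (Lemma 12.1): Suppose (α, β, γ) ∈ ℝ³ satisfies A·(α, β, γ)ᵀ = λ·(α, β, γ)ᵀ for some λ ∈ ℝ, and |α| + |β| ≠ 0. Then the linear function p(x,y) := α·x + β·y + γ satisfies 𝔍p(x,y) = p(x,y)·(λ − l₃(x,y)) for all (x,y) ∈ ℝ²; i.e., p is a partial integral of the Jacobi equation with cofactor (x,y) ↦ λ − l₃(x,y). -/
/-- Eigenvectors give linear partial integrals of the Jacobi equation (Lemma 12.1):
if `(α, β, γ)` is an eigenvector of the matrix `A` with eigenvalue `lam` and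
`|α| + |β| ≠ 0`, then `p(x,y) = α·x + β·y + γ` satisfies
`𝔍p = p·(lam − l₃)` everywhere. -/
theorem jacobi_eigenvector_partial_integral
    (a₁ a₂ a₃ b₁ b₂ b₃ c₁ c₂ c₃ : ℝ) (α β γ lam : ℝ)
    (hev : (!![a₁, a₂, a₃; b₁, b₂, b₃; c₁, c₂, c₃]).mulVec ![α, β, γ] =
      lam • ![α, β, γ])
    (hαβ : |α| + |β| ≠ 0) :
    ∀ x y : ℝ,
      fderiv ℝ (fun z : ℝ × ℝ => α * z.1 + β * z.2 + γ) (x, y)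
          ((a₁ * x + b₁ * y + c₁) - x * (a₃ * x + b₃ * y + c₃),
           (a₂ * x + b₂ * y + c₂) - y * (a₃ * x + b₃ * y + c₃)) =
        (α * x + β * y + γ) * (lam - (a₃ * x + b₃ * y + c₃)) := by
  intro x y
  have h₁ := congrFun hev 0
  have h₂ := congrFun hev 1
  have h₃ := congrFun hev 2
  simp only [Matrix.mulVec, dotProduct, Fin.sum_univ_three, Matrix.of_apply, Matrix.cons_val,
    Pi.smul_apply, smul_eq_mul] at h₁ h₂ h₃
  have hp : HasFDerivAt (fun z : ℝ × ℝ => α * z.1 + β * z.2 + γ)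
      (α • ContinuousLinearMap.fst ℝ ℝ ℝ + β • ContinuousLinearMap.snd ℝ ℝ ℝ) (x, y) :=
    ((hasFDerivAt_fst.const_mul α).add (hasFDerivAt_snd.const_mul β)).add_const γ
  rw [hp.fderiv]
  simp only [add_apply, smul_apply,
    ContinuousLinearMap.coe_fst', ContinuousLinearMap.coe_snd', smul_eq_mul]
  linear_combination x * h₁ + y * h₂ + h₃
end

section
/- General integral of the Jacobi equation for three distinct real eigenvalues (Theorem 12.9): Suppose λ₁, λ₂, λ₃ ∈ ℝ are pairwise distinct and (αᵢ, βᵢ, γᵢ) ∈ ℝ³ satisfy A·(αᵢ, βᵢ, γᵢ)ᵀ = λᵢ·(αᵢ, βᵢ, γᵢ)ᵀ for i = 1,2,3; set pᵢ(x,y) := αᵢ·x + βᵢ·y + γᵢ. Then the function F(x,y) := p₁(x,y)^{λ₂−λ₃}·p₂(x,y)^{λ₃−λ₁}·p₃(x,y)^{λ₁−λ₂} (real powers) is a general integral: 𝔍F(x,y) = 0 for every (x,y) ∈ ℝ² such that p₁(x,y) > 0, p₂(x,y) > 0 and p₃(x,y) > 0. -/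
/-- Real powers of a Darboux polynomial: if the affine function `α x + β y + γ` has cofactor `k`
along the direction `v`, then its `r`-th power has cofactor `r * k`. -/
theorem exists_hasFDerivAt_affine_rpow {α β γ x y k : ℝ} (r : ℝ) {v : ℝ × ℝ}
    (hpos : 0 < α * x + β * y + γ)
    (hk : α * v.1 + β * v.2 = k * (α * x + β * y + γ)) :
    ∃ f' : ℝ × ℝ →L[ℝ] ℝ,
      HasFDerivAt (fun z : ℝ × ℝ => (α * z.1 + β * z.2 + γ) ^ r) f' (x, y) ∧
        f' v = r * k * (α * x + β * y + γ) ^ r := by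
  have h : HasFDerivAt (fun z : ℝ × ℝ => α * z.1 + β * z.2 + γ)
      (α • ContinuousLinearMap.fst ℝ ℝ ℝ + β • ContinuousLinearMap.snd ℝ ℝ ℝ) (x, y) :=
    ((hasFDerivAt_fst.const_mul α).add (hasFDerivAt_snd.const_mul β)).add_const γ
  refine ⟨_, h.rpow_const (p := r) (Or.inl hpos.ne'), ?_⟩
  simp only [smul_apply, add_apply,
    ContinuousLinearMap.coe_fst', ContinuousLinearMap.coe_snd', smul_eq_mul, hk,
    Real.rpow_sub_one hpos.ne']
  field_simp

/-- An eigenvector of the coefficient matrix with eigenvalue `l` gives an affine function with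
cofactor `l - l₃` along the Jacobi vector field. -/
theorem jacobi_affine_cofactor {a₁ a₂ a₃ b₁ b₂ b₃ c₁ c₂ c₃ l α β γ : ℝ}
    (hev : (!![a₁, a₂, a₃; b₁, b₂, b₃; c₁, c₂, c₃]).mulVec ![α, β, γ] = l • ![α, β, γ])
    (x y : ℝ) :
    α * ((a₁ * x + b₁ * y + c₁) - x * (a₃ * x + b₃ * y + c₃)) +
        β * ((a₂ * x + b₂ * y + c₂) - y * (a₃ * x + b₃ * y + c₃)) =
      (l - (a₃ * x + b₃ * y + c₃)) * (α * x + β * y + γ) := by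
  have h₀ := congrFun hev 0
  have h₁ := congrFun hev 1
  have h₂ := congrFun hev 2
  simp [Matrix.mulVec, dotProduct, Fin.sum_univ_three] at h₀ h₁ h₂
  linear_combination x * h₀ + y * h₁ + h₂


/-- General integral of the Jacobi equation for three distinct real eigenvalues
(Theorem 12.9): with eigenpairs `(lamᵢ, (αᵢ, βᵢ, γᵢ))` of `A`, the function
`p₁^(lam₂−lam₃) · p₂^(lam₃−lam₁) · p₃^(lam₁−lam₂)` is a general integral at every
point where `p₁, p₂, p₃` are positive. -/
theorem jacobi_general_integral_three_eigenvalues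
    (a₁ a₂ a₃ b₁ b₂ b₃ c₁ c₂ c₃ : ℝ) (lam₁ lam₂ lam₃ : ℝ)
    (h₁₂ : lam₁ ≠ lam₂) (h₁₃ : lam₁ ≠ lam₃) (h₂₃ : lam₂ ≠ lam₃)
    (α₁ β₁ γ₁ α₂ β₂ γ₂ α₃ β₃ γ₃ : ℝ)
    (hev₁ : (!![a₁, a₂, a₃; b₁, b₂, b₃; c₁, c₂, c₃]).mulVec ![α₁, β₁, γ₁] =
      lam₁ • ![α₁, β₁, γ₁])
    (hev₂ : (!![a₁, a₂, a₃; b₁, b₂, b₃; c₁, c₂, c₃]).mulVec ![α₂, β₂, γ₂] =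
      lam₂ • ![α₂, β₂, γ₂])
    (hev₃ : (!![a₁, a₂, a₃; b₁, b₂, b₃; c₁, c₂, c₃]).mulVec ![α₃, β₃, γ₃] =
      lam₃ • ![α₃, β₃, γ₃]) :
    ∀ x y : ℝ,
      0 < α₁ * x + β₁ * y + γ₁ →
      0 < α₂ * x + β₂ * y + γ₂ →
      0 < α₃ * x + β₃ * y + γ₃ →
      fderiv ℝ (fun z : ℝ × ℝ =>
          (α₁ * z.1 + β₁ * z.2 + γ₁) ^ (lam₂ - lam₃) *
            (α₂ * z.1 + β₂ * z.2 + γ₂) ^ (lam₃ - lam₁) *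
            (α₃ * z.1 + β₃ * z.2 + γ₃) ^ (lam₁ - lam₂)) (x, y)
          ((a₁ * x + b₁ * y + c₁) - x * (a₃ * x + b₃ * y + c₃),
           (a₂ * x + b₂ * y + c₂) - y * (a₃ * x + b₃ * y + c₃)) = 0 := by
  intro x y hp₁ hp₂ hp₃
  obtain ⟨f₁, hf₁, hv₁⟩ :=
    exists_hasFDerivAt_affine_rpow (lam₂ - lam₃) hp₁ (v := (_, _)) (jacobi_affine_cofactor hev₁ x y)
  obtain ⟨f₂, hf₂, hv₂⟩ :=
    exists_hasFDerivAt_affine_rpow (lam₃ - lam₁) hp₂ (v := (_, _)) (jacobi_affine_cofactor hev₂ x y)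
  obtain ⟨f₃, hf₃, hv₃⟩ :=
    exists_hasFDerivAt_affine_rpow (lam₁ - lam₂) hp₃ (v := (_, _)) (jacobi_affine_cofactor hev₃ x y)
  rw [((hf₁.fun_mul hf₂).fun_mul hf₃).fderiv]
  simp only [smul_apply, add_apply, smul_eq_mul,
    hv₁, hv₂, hv₃]
  ring
end

section
/- General integral of the Jacobi equation for a multiple eigenvalue with two eigenvectors (Theorem 12.10): Suppose λ ∈ ℝ and two vectors (α₁, β₁, γ₁), (α₂, β₂, γ₂) ∈ ℝ³ both satisfy A·v = λ·v; set pᵢ(x,y) := αᵢ·x + βᵢ·y + γᵢ for i = 1,2. Then the homographic function p₁/p₂ is a general integral on D := {(x,y) ∈ ℝ² : p₂(x,y) ≠ 0}: for every (x,y) ∈ D, 𝔍(p₁/p₂)(x,y) = 0. -/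
/-- The affine function attached to an eigenvector of the coefficient matrix is multiplied by the
cofactor `lam - l₃` under the derivative by virtue of the Jacobi equation. -/
theorem jacobi_eigenvector_cofactor
    {a₁ a₂ a₃ b₁ b₂ b₃ c₁ c₂ c₃ lam α β γ : ℝ}
    (hev : (!![a₁, a₂, a₃; b₁, b₂, b₃; c₁, c₂, c₃]).mulVec ![α, β, γ] = lam • ![α, β, γ])
    (x y : ℝ) :
    α * ((a₁ * x + b₁ * y + c₁) - x * (a₃ * x + b₃ * y + c₃)) +
        β * ((a₂ * x + b₂ * y + c₂) - y * (a₃ * x + b₃ * y + c₃)) =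
      (lam - (a₃ * x + b₃ * y + c₃)) * (α * x + β * y + γ) := by
  have h₀ := congrFun hev 0
  have h₁ := congrFun hev 1
  have h₂ := congrFun hev 2
  simp [Matrix.mulVec, dotProduct, Fin.sum_univ_three] at h₀ h₁ h₂
  linear_combination x * h₀ + y * h₁ + h₂

theorem hasFDerivAt_affine_prod (α β γ : ℝ) (z : ℝ × ℝ) :
    HasFDerivAt (fun z : ℝ × ℝ => α * z.1 + β * z.2 + γ)
      (α • ContinuousLinearMap.fst ℝ ℝ ℝ + β • ContinuousLinearMap.snd ℝ ℝ ℝ) z :=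
  ((hasFDerivAt_fst.const_mul α).add (hasFDerivAt_snd.const_mul β)).add_const γ

/-- General integral of the Jacobi equation for a multiple eigenvalue with two
eigenvectors (Theorem 12.10): if `(α₁, β₁, γ₁)` and `(α₂, β₂, γ₂)` are both
eigenvectors of `A` with the same eigenvalue `lam`, then `p₁ / p₂` is a general
integral on the set where `p₂ ≠ 0`. -/
theorem jacobi_general_integral_double_eigenvalue
    (a₁ a₂ a₃ b₁ b₂ b₃ c₁ c₂ c₃ : ℝ) (lam : ℝ)
    (α₁ β₁ γ₁ α₂ β₂ γ₂ : ℝ)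
    (hev₁ : (!![a₁, a₂, a₃; b₁, b₂, b₃; c₁, c₂, c₃]).mulVec ![α₁, β₁, γ₁] =
      lam • ![α₁, β₁, γ₁])
    (hev₂ : (!![a₁, a₂, a₃; b₁, b₂, b₃; c₁, c₂, c₃]).mulVec ![α₂, β₂, γ₂] =
      lam • ![α₂, β₂, γ₂]) :
    ∀ x y : ℝ, α₂ * x + β₂ * y + γ₂ ≠ 0 →
      fderiv ℝ (fun z : ℝ × ℝ =>
          (α₁ * z.1 + β₁ * z.2 + γ₁) / (α₂ * z.1 + β₂ * z.2 + γ₂)) (x, y)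
          ((a₁ * x + b₁ * y + c₁) - x * (a₃ * x + b₃ * y + c₃),
           (a₂ * x + b₂ * y + c₂) - y * (a₃ * x + b₃ * y + c₃)) = 0 := by
  intro x y hp
  have hd := (hasFDerivAt_affine_prod α₁ β₁ γ₁ (x, y)).mul
    ((hasDerivAt_inv hp).comp_hasFDerivAt (x, y) (hasFDerivAt_affine_prod α₂ β₂ γ₂ (x, y)))
  have h₁ := jacobi_eigenvector_cofactor hev₁ x y
  have h₂ := jacobi_eigenvector_cofactor hev₂ x y
  simp only [div_eq_mul_inv]
  refine (DFunLike.congr_fun hd.fderiv _).trans ?_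
  simp only [smul_apply, add_apply, ContinuousLinearMap.coe_fst', ContinuousLinearMap.coe_snd',
    smul_eq_mul, Function.comp_apply, h₁, h₂]
  field_simp
  ring
end

section
/- General integral of the Jacobi equation for a complex eigenvalue (Theorem 12.11): Let ξ, ζ ∈ ℝ with ζ ≠ 0, and suppose (α, β, γ) ∈ ℂ³ satisfies A_ℂ·(α, β, γ)ᵀ = (ξ + ζ·i)·(α, β, γ)ᵀ, where A_ℂ is the matrix A with its real entries regarded as complex numbers; suppose also λ₃ ∈ ℝ and (α₃, β₃, γ₃) ∈ ℝ³ satisfy A·(α₃, β₃, γ₃)ᵀ = λ₃·(α₃, β₃, γ₃)ᵀ. Set p(x,y) := α·x + β·y + γ ∈ ℂ, u(x,y) := Re p(x,y), v(x,y) := Im p(x,y), and p₃(x,y) := α₃·x + β₃·y + γ₃. Then the function F(x,y) := ((u(x,y)² + v(x,y)²)/p₃(x,y)²)^ζ · exp(2·(λ₃ − ξ)·arctan(v(x,y)/u(x,y))) satisfies 𝔍F(x,y) = 0 at every (x,y) ∈ ℝ² with u(x,y) ≠ 0 and p₃(x,y) ≠ 0. -/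
/-- If along a direction `w` the functions `u + v·i` and `q` are infinitesimally scaled by
`μ + ζ·i` and `ν`, then `((u² + v²)/q²)^ζ · exp (2·(ν − μ)·arctan (v/u))` is stationary
along `w`. -/
theorem fderiv_rpow_mul_exp_arctan_apply_eq_zero {E : Type*} [NormedAddCommGroup E]
    [NormedSpace ℝ E] {u v q : E → ℝ} {u' v' q' : E →L[ℝ] ℝ} {z w : E} {μ ν ζ κ : ℝ}
    (hu : HasFDerivAt u u' z) (hv : HasFDerivAt v v' z) (hq : HasFDerivAt q q' z)
    (hu0 : u z ≠ 0) (hq0 : q z ≠ 0)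
    (hu' : u' w = μ * u z - ζ * v z) (hv' : v' w = μ * v z + ζ * u z)
    (hq' : q' w = ν * q z) (hκ : κ = 2 * (ν - μ)) :
    fderiv ℝ (fun z => ((u z ^ 2 + v z ^ 2) / q z ^ 2) ^ ζ *
      Real.exp (κ * Real.arctan (v z / u z))) z w = 0 := by
  subst hκ
  have hR : 0 < (u z ^ 2 + v z ^ 2) / q z ^ 2 := by positivity
  have hinv (f : E → ℝ) (f' : E →L[ℝ] ℝ) (hf : HasFDerivAt f f' z) (h0 : f z ≠ 0) :
      HasFDerivAt (fun z => (f z)⁻¹) (-(f z ^ 2)⁻¹ • f') z :=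
    (hasDerivAt_inv h0).comp_hasFDerivAt z hf
  have hdiv := ((hu.pow 2).fun_add (hv.pow 2)).fun_mul
    (hinv _ _ (hq.pow 2) (pow_ne_zero 2 hq0))
  have harg := hv.fun_mul (hinv _ _ hu hu0)
  simp only [div_eq_mul_inv] at hR ⊢
  have hF := (hdiv.rpow_const (p := ζ) (Or.inl hR.ne')).mul
    ((harg.arctan.const_mul (2 * (ν - μ))).exp)
  refine (congrArg (fun L : E →L[ℝ] ℝ => L w) hF.fderiv).trans ?_
  simp [hu', hv', hq', Real.rpow_sub_one hR.ne']
  field_simp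
  ring


/-- General integral of the Jacobi equation for a complex eigenvalue (Theorem 12.11):
if `(α, β, γ) ∈ ℂ³` is an eigenvector of the complexified matrix with eigenvalue
`ξ + ζ·i` (`ζ ≠ 0`) and `(α₃, β₃, γ₃)` is a real eigenvector with eigenvalue `lam₃`,
then `F = ((u² + v²)/p₃²)^ζ · exp (2·(lam₃ − ξ)·arctan (v/u))` is a general integral
at every point where `u ≠ 0` and `p₃ ≠ 0`. -/
theorem jacobi_general_integral_complex_eigenvalue
    (a₁ a₂ a₃ b₁ b₂ b₃ c₁ c₂ c₃ : ℝ) (ξ ζ : ℝ) (hζ : ζ ≠ 0)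
    (α β γ : ℂ)
    (hev : (!![(a₁ : ℂ), (a₂ : ℂ), (a₃ : ℂ); (b₁ : ℂ), (b₂ : ℂ), (b₃ : ℂ);
        (c₁ : ℂ), (c₂ : ℂ), (c₃ : ℂ)]).mulVec ![α, β, γ] =
      ((ξ : ℂ) + (ζ : ℂ) * Complex.I) • ![α, β, γ])
    (lam₃ : ℝ) (α₃ β₃ γ₃ : ℝ)
    (hev₃ : (!![a₁, a₂, a₃; b₁, b₂, b₃; c₁, c₂, c₃]).mulVec ![α₃, β₃, γ₃] =
      lam₃ • ![α₃, β₃, γ₃]) :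
    ∀ x y : ℝ,
      (α * (x : ℂ) + β * (y : ℂ) + γ).re ≠ 0 →
      α₃ * x + β₃ * y + γ₃ ≠ 0 →
      fderiv ℝ (fun z : ℝ × ℝ =>
          (((α * (z.1 : ℂ) + β * (z.2 : ℂ) + γ).re ^ 2 +
              (α * (z.1 : ℂ) + β * (z.2 : ℂ) + γ).im ^ 2) /
            (α₃ * z.1 + β₃ * z.2 + γ₃) ^ 2) ^ ζ *
          Real.exp (2 * (lam₃ - ξ) *
            Real.arctan ((α * (z.1 : ℂ) + β * (z.2 : ℂ) + γ).im /
              (α * (z.1 : ℂ) + β * (z.2 : ℂ) + γ).re))) (x, y)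
          ((a₁ * x + b₁ * y + c₁) - x * (a₃ * x + b₃ * y + c₃),
           (a₂ * x + b₂ * y + c₂) - y * (a₃ * x + b₃ * y + c₃)) = 0 := by
  intro x y hu0 hq0
  have hx : HasFDerivAt (fun z : ℝ × ℝ => z.1) (ContinuousLinearMap.fst ℝ ℝ ℝ) (x, y) :=
    hasFDerivAt_fst
  have hy : HasFDerivAt (fun z : ℝ × ℝ => z.2) (ContinuousLinearMap.snd ℝ ℝ ℝ) (x, y) :=
    hasFDerivAt_snd
  have haff (a b c : ℝ) := ((hx.const_mul a).add (hy.const_mul b)).add_const c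
  have hre : ∀ s t : ℝ, (α * (s : ℂ) + β * (t : ℂ) + γ).re = α.re * s + β.re * t + γ.re := by
    intro s t; simp
  have him : ∀ s t : ℝ, (α * (s : ℂ) + β * (t : ℂ) + γ).im = α.im * s + β.im * t + γ.im := by
    intro s t; simp
  simp only [hre, him] at hu0 ⊢
  have h0 := congrFun hev 0
  have h1 := congrFun hev 1
  have h2 := congrFun hev 2
  have k0 := congrFun hev₃ 0
  have k1 := congrFun hev₃ 1
  have k2 := congrFun hev₃ 2
  simp [Matrix.mulVec, dotProduct, Fin.sum_univ_three, Complex.ext_iff] at h0 h1 h2 k0 k1 k2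
  refine fderiv_rpow_mul_exp_arctan_apply_eq_zero
    (μ := ξ - (a₃ * x + b₃ * y + c₃)) (ν := lam₃ - (a₃ * x + b₃ * y + c₃))
    (haff α.re β.re γ.re) (haff α.im β.im γ.im) (haff α₃ β₃ γ₃) hu0 hq0 ?_ ?_ ?_ (by ring)
  · simp
    linear_combination x * h0.1 + y * h1.1 + h2.1
  · simp
    linear_combination x * h0.2 + y * h1.2 + h2.2
  · simp
    linear_combination x * k0 + y * k1 + k2
end

section
/- Generalized eigenvectors give multiple partial integrals of the Jacobi equation (Lemma 12.2): Let λ ∈ ℝ, let θ = (α, β, γ) ∈ ℝ³ satisfy A·θ = λ·θ, and let θ⁽¹⁾ = (α⁽¹⁾, β⁽¹⁾, γ⁽¹⁾) ∈ ℝ³ satisfy (A − λ·I)·θ⁽¹⁾ = θ. Set p(x,y) := α·x + β·y + γ and p⁽¹⁾(x,y) := α⁽¹⁾·x + β⁽¹⁾·y + γ⁽¹⁾. Then 𝔍p⁽¹⁾(x,y) = p(x,y) + p⁽¹⁾(x,y)·(λ − l₃(x,y)) for all (x,y) ∈ ℝ², and consequently 𝔍(p⁽¹⁾/p)(x,y)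 = 1 for every (x,y) ∈ ℝ² with p(x,y) ≠ 0. -/
/-- The Fréchet derivative of an affine function of two real variables. -/
theorem hasFDerivAt_affine_prod_s17 (a b c : ℝ) (z : ℝ × ℝ) :
    HasFDerivAt (fun w : ℝ × ℝ => a * w.1 + b * w.2 + c)
      (a • ContinuousLinearMap.fst ℝ ℝ ℝ + b • ContinuousLinearMap.snd ℝ ℝ ℝ) z :=
  ((hasFDerivAt_fst.const_mul a).add (hasFDerivAt_snd.const_mul b)).add_const c


/-- Generalized eigenvectors give multiple partial integrals of the Jacobi equation
(Lemma 12.2): if `A·θ = lam·θ` and `(A − lam·I)·θ⁽¹⁾ = θ`, then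
`𝔍p⁽¹⁾ = p + p⁽¹⁾·(lam − l₃)` everywhere, and `𝔍(p⁽¹⁾/p) = 1` wherever `p ≠ 0`. -/
theorem jacobi_generalized_eigenvector_multiple_integral
    (a₁ a₂ a₃ b₁ b₂ b₃ c₁ c₂ c₃ : ℝ) (lam : ℝ)
    (α β γ α' β' γ' : ℝ)
    (hev : (!![a₁, a₂, a₃; b₁, b₂, b₃; c₁, c₂, c₃]).mulVec ![α, β, γ] =
      lam • ![α, β, γ])
    (hgen : ((!![a₁, a₂, a₃; b₁, b₂, b₃; c₁, c₂, c₃]) -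
        lam • (1 : Matrix (Fin 3) (Fin 3) ℝ)).mulVec ![α', β', γ'] = ![α, β, γ]) :
    (∀ x y : ℝ,
      fderiv ℝ (fun z : ℝ × ℝ => α' * z.1 + β' * z.2 + γ') (x, y)
          ((a₁ * x + b₁ * y + c₁) - x * (a₃ * x + b₃ * y + c₃),
           (a₂ * x + b₂ * y + c₂) - y * (a₃ * x + b₃ * y + c₃)) =
        (α * x + β * y + γ) +
          (α' * x + β' * y + γ') * (lam - (a₃ * x + b₃ * y + c₃))) ∧
    (∀ x y : ℝ, α * x + β * y + γ ≠ 0 →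
      fderiv ℝ (fun z : ℝ × ℝ =>
          (α' * z.1 + β' * z.2 + γ') / (α * z.1 + β * z.2 + γ)) (x, y)
          ((a₁ * x + b₁ * y + c₁) - x * (a₃ * x + b₃ * y + c₃),
           (a₂ * x + b₂ * y + c₂) - y * (a₃ * x + b₃ * y + c₃)) = 1) := by
  simp only [Matrix.sub_mulVec, Matrix.smul_mulVec, Matrix.one_mulVec] at hgen
  have e₀ := congrFun hev 0
  have e₁ := congrFun hev 1
  have e₂ := congrFun hev 2
  have g₀ := congrFun hgen 0
  have g₁ := congrFun hgen 1
  have g₂ := congrFun hgen 2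
  simp [Matrix.mulVec, dotProduct, Fin.sum_univ_three] at e₀ e₁ e₂ g₀ g₁ g₂
  refine ⟨fun x y => ?_, fun x y hp => ?_⟩
  · rw [(hasFDerivAt_affine_prod_s17 α' β' γ' (x, y)).fderiv]
    simp only [add_apply, smul_apply,
      ContinuousLinearMap.coe_fst', ContinuousLinearMap.coe_snd', smul_eq_mul]
    linear_combination x * g₀ + y * g₁ + g₂
  · have hq := (hasFDerivAt_affine_prod_s17 α' β' γ' (x, y)).fun_mul
      ((hasDerivAt_inv hp).comp_hasFDerivAt (x, y) (hasFDerivAt_affine_prod_s17 α β γ (x, y)))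
    simp only [Function.comp_apply, ← div_eq_mul_inv] at hq
    rw [hq.fderiv]
    simp only [add_apply, smul_apply,
      ContinuousLinearMap.coe_fst', ContinuousLinearMap.coe_snd', smul_eq_mul]
    have hr := mul_inv_cancel₀ hp
    rw [← inv_pow]
    generalize (α * x + β * y + γ)⁻¹ = r at hr ⊢
    linear_combination (1 - r * (α' * x + β' * y + γ') * (lam - (a₃ * x + b₃ * y + c₃))) * hr +
      r * (x * g₀ + y * g₁ + g₂) -
      (α' * x + β' * y + γ') * r ^ 2 * (x * e₀ + y * e₁ + e₂)
end

section
/- General integral of the Jacobi equation for a triple elementary divisor (Theorem 12.13): Let λ₁ ∈ ℝ and θ₁, θ₁⁽¹⁾, θ₁⁽²⁾ ∈ ℝ³ satisfy A·θ₁ = λ₁·θ₁, (A − λ₁·I)·θ₁⁽¹⁾ = θ₁ and (A − λ₁·I)·θ₁⁽²⁾ = 2·θ₁⁽¹⁾. Writing θ₁ = (α₁, β₁, γ₁), θ₁⁽¹⁾ = (α₁⁽¹⁾, β₁⁽¹⁾, γ₁⁽¹⁾), θ₁⁽²⁾ = (α₁⁽²⁾, β₁⁽²⁾, γ₁⁽²⁾),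 set p₁(x,y) := α₁·x + β₁·y + γ₁, p₁⁽¹⁾(x,y) := α₁⁽¹⁾·x + β₁⁽¹⁾·y + γ₁⁽¹⁾, and p₁⁽²⁾(x,y) := α₁⁽²⁾·x + β₁⁽²⁾·y + γ₁⁽²⁾. Then the rational function F(x,y) := ((p₁⁽¹⁾(x,y))² − p₁(x,y)·p₁⁽²⁾(x,y)) / p₁(x,y)² satisfies 𝔍F(x,y) = 0 at every (x,y) ∈ ℝ² with p₁(x,y) ≠ 0. -/
/-- If along a direction `v` the derivatives of `p`, `q`, `r` are `k p`, `k q + p` and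
`k r + 2 q`, then the derivative of `(q² - p r) / p²` along `v` vanishes. -/
theorem fderiv_sq_sub_mul_div_sq_apply_eq_zero {E : Type*} [NormedAddCommGroup E]
    [NormedSpace ℝ E] {p q r : E → ℝ} {p' q' r' : E →L[ℝ] ℝ} {z v : E} {k : ℝ}
    (hp : HasFDerivAt p p' z) (hq : HasFDerivAt q q' z) (hr : HasFDerivAt r r' z)
    (hz : p z ≠ 0) (hpv : p' v = k * p z) (hqv : q' v = k * q z + p z)
    (hrv : r' v = k * r z + 2 * q z) :
    fderiv ℝ (fun w => (q w ^ 2 - p w * r w) / p w ^ 2) z v = 0 := by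
  have h := ((hq.pow 2).sub (hp.mul hr)).mul
    ((hasDerivAt_inv (pow_ne_zero 2 hz)).comp_hasFDerivAt z (hp.pow 2))
  refine (congrArg (fun L : E →L[ℝ] ℝ => L v) h.fderiv).trans ?_
  simp [hpv, hqv, hrv]
  field_simp
  ring

/-- General integral of the Jacobi equation for a triple elementary divisor
(Theorem 12.13): with `A·θ₁ = lam₁·θ₁`, `(A − lam₁·I)·θ₁⁽¹⁾ = θ₁` and
`(A − lam₁·I)·θ₁⁽²⁾ = 2·θ₁⁽¹⁾`, the rational function
`((p₁⁽¹⁾)² − p₁·p₁⁽²⁾)/p₁²` is a general integral at every point where `p₁ ≠ 0`. -/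
theorem jacobi_general_integral_triple_divisor
    (a₁ a₂ a₃ b₁ b₂ b₃ c₁ c₂ c₃ : ℝ) (lam₁ : ℝ)
    (α₁ β₁ γ₁ α₁' β₁' γ₁' α₁'' β₁'' γ₁'' : ℝ)
    (hev₁ : (!![a₁, a₂, a₃; b₁, b₂, b₃; c₁, c₂, c₃]).mulVec ![α₁, β₁, γ₁] =
      lam₁ • ![α₁, β₁, γ₁])
    (hgen₁ : ((!![a₁, a₂, a₃; b₁, b₂, b₃; c₁, c₂, c₃]) -
        lam₁ • (1 : Matrix (Fin 3) (Fin 3) ℝ)).mulVec ![α₁', β₁', γ₁'] = ![α₁, β₁, γ₁])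
    (hgen₂ : ((!![a₁, a₂, a₃; b₁, b₂, b₃; c₁, c₂, c₃]) -
        lam₁ • (1 : Matrix (Fin 3) (Fin 3) ℝ)).mulVec ![α₁'', β₁'', γ₁''] =
      (2 : ℝ) • ![α₁', β₁', γ₁']) :
    ∀ x y : ℝ,
      α₁ * x + β₁ * y + γ₁ ≠ 0 →
      fderiv ℝ (fun z : ℝ × ℝ =>
          ((α₁' * z.1 + β₁' * z.2 + γ₁') ^ 2 -
            (α₁ * z.1 + β₁ * z.2 + γ₁) * (α₁'' * z.1 + β₁'' * z.2 + γ₁'')) /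
            (α₁ * z.1 + β₁ * z.2 + γ₁) ^ 2) (x, y)
          ((a₁ * x + b₁ * y + c₁) - x * (a₃ * x + b₃ * y + c₃),
           (a₂ * x + b₂ * y + c₂) - y * (a₃ * x + b₃ * y + c₃)) = 0 := by
  intro x y hp
  simp [funext_iff, Fin.forall_fin_succ, Matrix.mulVec, dotProduct, Fin.sum_univ_three,
    Matrix.one_apply, -Matrix.cons_mulVec, -Matrix.mulVec_cons] at hev₁ hgen₁ hgen₂
  obtain ⟨e₁, e₂, e₃⟩ := hev₁
  obtain ⟨f₁, f₂, f₃⟩ := hgen₁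
  obtain ⟨g₁, g₂, g₃⟩ := hgen₂
  refine fderiv_sq_sub_mul_div_sq_apply_eq_zero (k := lam₁ - (a₃ * x + b₃ * y + c₃))
    (hasFDerivAt_affine_prod α₁ β₁ γ₁ (x, y)) (hasFDerivAt_affine_prod α₁' β₁' γ₁' (x, y))
    (hasFDerivAt_affine_prod α₁'' β₁'' γ₁'' (x, y)) hp ?_ ?_ ?_ <;> simp
  · linear_combination x * e₁ + y * e₂ + e₃
  · linear_combination x * f₁ + y * f₂ + f₃
  · linear_combination x * g₁ + y * g₂ + g₃
end
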